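/- arXiv:2604.09699 — 3 statements merged into one kernel-verified Lean document; each statement's English description precedes it below -/
import Mathlib

section
/- The operator T : C_0²(I) → C_0²(I) is a contraction with ratio S̄: for all g, h ∈ C_0²(I), D(Tg, Th) ≤ S̄·D(g, h). Consequently T has a unique fixed point f = (f_1, f_2) ∈ C_0²(I). -/
open Set

namespace ZHV

noncomputable section

variable {n : ℕ}

/-- Index `i-1+ε_i` (image of `x₀` under `L_i`). -/
def e0 (ε : Fin n → Bool) (i : Fin n) : Fin (n + 1) :=
  if ε i then i.succ else i.castSucc

/-- Index `i-ε_i` (image of `x_n` under `L_i`). -/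
def e1 (ε : Fin n → Bool) (i : Fin n) : Fin (n + 1) :=
  if ε i then i.castSucc else i.succ

/-- The interval `I = [x₀, x_n]`. -/
def Ifull (X : Fin (n + 1) → ℝ) : Set ℝ := Icc (X 0) (X (Fin.last n))

/-- The subinterval `I_i = [x_{i-1}, x_i]`. -/
def Isub (X : Fin (n + 1) → ℝ) (i : Fin n) : Set ℝ := Icc (X i.castSucc) (X i.succ)

def acoef (X : Fin (n + 1) → ℝ) (ε : Fin n → Bool) (i : Fin n) : ℝ :=
  (X (e1 ε i) - X (e0 ε i)) / (X (Fin.last n) - X 0)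

def bcoef (X : Fin (n + 1) → ℝ) (ε : Fin n → Bool) (i : Fin n) : ℝ :=
  (X (e0 ε i) * X (Fin.last n) - X (e1 ε i) * X 0) / (X (Fin.last n) - X 0)

/-- `L_i(t) = a_i t + b_i`. -/
def Lmap (X : Fin (n + 1) → ℝ) (ε : Fin n → Bool) (i : Fin n) (t : ℝ) : ℝ :=
  acoef X ε i * t + bcoef X ε i

/-- `L_i⁻¹`. -/
def Linv (X : Fin (n + 1) → ℝ) (ε : Fin n → Bool) (i : Fin n) (t : ℝ) : ℝ :=
  (t - bcoef X ε i) / acoef X ε i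

/-- `μ(t) = (t - x₀)/(x_n - x₀)`. -/
def mu (X : Fin (n + 1) → ℝ) (t : ℝ) : ℝ := (t - X 0) / (X (Fin.last n) - X 0)

/-- The affine function through `(x₀, w₀)` and `(x_n, w_n)`:
`μ(t)·w_n + (1-μ(t))·w₀`. -/
def base (X W : Fin (n + 1) → ℝ) (t : ℝ) : ℝ :=
  mu X t * W (Fin.last n) + (1 - mu X t) * W 0

/-- `F_{i,1}`. -/
def F1 (X Y Z : Fin (n + 1) → ℝ) (ε : Fin n → Bool) (p q : Fin n → ℝ → ℝ)
    (i : Fin n) (t yv zv : ℝ) : ℝ :=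
  p i (Lmap X ε i t) * (yv - base X Y t) + q i (Lmap X ε i t) * (zv - base X Z t)
    + (mu X t * Y (e1 ε i) + (1 - mu X t) * Y (e0 ε i))

/-- `F_{i,2}`. -/
def F2 (X Y Z : Fin (n + 1) → ℝ) (ε : Fin n → Bool) (pt qt : Fin n → ℝ → ℝ)
    (i : Fin n) (t yv zv : ℝ) : ℝ :=
  pt i (Lmap X ε i t) * (yv - base X Y t) + qt i (Lmap X ε i t) * (zv - base X Z t)
    + (mu X t * Z (e1 ε i) + (1 - mu X t) * Z (e0 ε i))

/-- `ω_i(x,y,z) = (L_i(x), F_{i,1}(x,y,z), F_{i,2}(x,y,z))`. -/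
def wmap (X Y Z : Fin (n + 1) → ℝ) (ε : Fin n → Bool) (p q pt qt : Fin n → ℝ → ℝ)
    (i : Fin n) (P : ℝ × ℝ × ℝ) : ℝ × ℝ × ℝ :=
  (Lmap X ε i P.1, F1 X Y Z ε p q i P.1 P.2.1 P.2.2, F2 X Y Z ε pt qt i P.1 P.2.1 P.2.2)

/-- `r_i`. -/
def rmap (X Y Z : Fin (n + 1) → ℝ) (ε : Fin n → Bool) (p q : Fin n → ℝ → ℝ)
    (i : Fin n) (t : ℝ) : ℝ :=
  (mu X t * Y (e1 ε i) + (1 - mu X t) * Y (e0 ε i))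
    - p i (Lmap X ε i t) * base X Y t - q i (Lmap X ε i t) * base X Z t

/-- `r̃_i`. -/
def rtmap (X Y Z : Fin (n + 1) → ℝ) (ε : Fin n → Bool) (pt qt : Fin n → ℝ → ℝ)
    (i : Fin n) (t : ℝ) : ℝ :=
  (mu X t * Z (e1 ε i) + (1 - mu X t) * Z (e0 ε i))
    - pt i (Lmap X ε i t) * base X Y t - qt i (Lmap X ε i t) * base X Z t

/-- Sup norm of `g` on the subinterval `I_i`. -/
def snormSub (X : Fin (n + 1) → ℝ) (i : Fin n) (g : ℝ → ℝ) : ℝ :=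
  sSup ((fun t => |g t|) '' Isub X i)

/-- Sup norm of `g` on `I`. -/
def snormFull (X : Fin (n + 1) → ℝ) (g : ℝ → ℝ) : ℝ :=
  sSup ((fun t => |g t|) '' Ifull X)

/-- The constant `U`. -/
def Uval (X Y Z : Fin (n + 1) → ℝ) (ε : Fin n → Bool) (p q pt qt : Fin n → ℝ → ℝ) : ℝ :=
  ⨆ i : Fin n,
    (snormSub X i (q i) * snormFull X (rtmap X Y Z ε pt qt i)
        + (1 - snormSub X i (qt i)) * snormFull X (rmap X Y Z ε p q i)) /
      ((1 - snormSub X i (p i)) * (1 - snormSub X i (qt i))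
        - snormSub X i (pt i) * snormSub X i (q i))

/-- The constant `Ũ`. -/
def Utval (X Y Z : Fin (n + 1) → ℝ) (ε : Fin n → Bool) (p q pt qt : Fin n → ℝ → ℝ) : ℝ :=
  ⨆ i : Fin n,
    (snormSub X i (pt i) * snormFull X (rmap X Y Z ε p q i)
        + (1 - snormSub X i (p i)) * snormFull X (rtmap X Y Z ε pt qt i)) /
      ((1 - snormSub X i (p i)) * (1 - snormSub X i (qt i))
        - snormSub X i (pt i) * snormSub X i (q i))

/-- The set `E = [-U,U] × [-Ũ,Ũ]`. -/
def Eset (X Y Z : Fin (n + 1) → ℝ) (ε : Fin n → Bool) (p q pt qt : Fin n → ℝ → ℝ) :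
    Set (ℝ × ℝ) :=
  Icc (-(Uval X Y Z ε p q pt qt)) (Uval X Y Z ε p q pt qt) ×ˢ
    Icc (-(Utval X Y Z ε p q pt qt)) (Utval X Y Z ε p q pt qt)

/-- `S̄ = max_i max{‖p_i‖+‖p̃_i‖, ‖q_i‖+‖q̃_i‖}`. -/
def Sbar (X : Fin (n + 1) → ℝ) (p q pt qt : Fin n → ℝ → ℝ) : ℝ :=
  ⨆ i : Fin n,
    max (snormSub X i (p i) + snormSub X i (pt i))
      (snormSub X i (q i) + snormSub X i (qt i))

/-- Minimum value of `g` on `I_i`. -/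
def fmin (X : Fin (n + 1) → ℝ) (i : Fin n) (g : ℝ → ℝ) : ℝ := sInf (g '' Isub X i)

/-- Maximum value of `g` on `I_i`. -/
def fmax (X : Fin (n + 1) → ℝ) (i : Fin n) (g : ℝ → ℝ) : ℝ := sSup (g '' Isub X i)

/-- The constant `M` of Section 4. -/
def Mval (X Y Z : Fin (n + 1) → ℝ) (p q pt qt : Fin n → ℝ → ℝ) : ℝ :=
  ((⨆ j, Y j) + (⨆ j, Z j)
      - (⨆ i : Fin n, (max (snormSub X i (p i)) (snormSub X i (q i))
          + max (snormSub X i (pt i)) (snormSub X i (qt i))))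
        * (min (Y 0) (Y (Fin.last n)) + min (Z 0) (Z (Fin.last n)))) /
    (1 - ⨆ i : Fin n, (max (snormSub X i (p i)) (snormSub X i (q i))
        + max (snormSub X i (pt i)) (snormSub X i (qt i))))

/-- The slope `m_i = (y_i - y_{i-1})/(x_i - x_{i-1})`. -/
def mslope (X Y : Fin (n + 1) → ℝ) (i : Fin n) : ℝ :=
  (Y i.succ - Y i.castSucc) / (X i.succ - X i.castSucc)

/-- The standing hypotheses: the `x_i` are strictly increasing, the vertical scaling
factors are Lipschitz on `I_i` and satisfy `‖p_i‖+‖p̃_i‖ < 1` and `‖q_i‖+‖q̃_i‖ < 1`. -/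
def Hyps (X : Fin (n + 1) → ℝ) (p q pt qt : Fin n → ℝ → ℝ) : Prop :=
  StrictMono X ∧
  (∀ i, ∃ K : NNReal, LipschitzOnWith K (p i) (Isub X i)) ∧
  (∀ i, ∃ K : NNReal, LipschitzOnWith K (pt i) (Isub X i)) ∧
  (∀ i, ∃ K : NNReal, LipschitzOnWith K (q i) (Isub X i)) ∧
  (∀ i, ∃ K : NNReal, LipschitzOnWith K (qt i) (Isub X i)) ∧
  (∀ i, snormSub X i (p i) + snormSub X i (pt i) < 1) ∧
  (∀ i, snormSub X i (q i) + snormSub X i (qt i) < 1)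

/-- `(f₁,f₂)` is a fixed point of the Read operator `T` on `C₀²(I)`:
it belongs to `C₀²(I)` and satisfies `f(x) = F_i(L_i⁻¹(x), f(L_i⁻¹(x)))` on each `I_i`. -/
def IsFixedPt (X Y Z : Fin (n + 1) → ℝ) (ε : Fin n → Bool)
    (p q pt qt : Fin n → ℝ → ℝ) (f1 f2 : ℝ → ℝ) : Prop :=
  ContinuousOn f1 (Ifull X) ∧ ContinuousOn f2 (Ifull X) ∧
  f1 (X 0) = Y 0 ∧ f2 (X 0) = Z 0 ∧
  f1 (X (Fin.last n)) = Y (Fin.last n) ∧ f2 (X (Fin.last n)) = Z (Fin.last n) ∧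
  ∀ i : Fin n, ∀ t ∈ Isub X i,
    f1 t = F1 X Y Z ε p q i (Linv X ε i t) (f1 (Linv X ε i t)) (f2 (Linv X ε i t)) ∧
    f2 t = F2 X Y Z ε pt qt i (Linv X ε i t) (f1 (Linv X ε i t)) (f2 (Linv X ε i t))

/-- The graph `{(x, f₁(x), f₂(x)) : x ∈ I}`. -/
def Graph (X : Fin (n + 1) → ℝ) (f1 f2 : ℝ → ℝ) : Set (ℝ × ℝ × ℝ) :=
  (fun t => (t, f1 t, f2 t)) '' Ifull X

/-- The metric `ρ_θ`. -/
def rho (θ : ℝ) (P Q : ℝ × ℝ × ℝ) : ℝ :=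
  |P.1 - Q.1| + θ * (|P.2.1 - Q.2.1| + |P.2.2 - Q.2.2|)

/-- The Euclidean distance on `ℝ³`. -/
def euclDist (P Q : ℝ × ℝ × ℝ) : ℝ :=
  Real.sqrt ((P.1 - Q.1) ^ 2 + (P.2.1 - Q.2.1) ^ 2 + (P.2.2 - Q.2.2) ^ 2)

end

end ZHV

open ZHV Set

namespace ZHV

section ReadOperator

open WithLp

variable {n : ℕ} {X Y Z : Fin (n + 1) → ℝ} {ε : Fin n → Bool} {p q pt qt : Fin n → ℝ → ℝ}

lemma F2_eq_F1_swap (X Y Z : Fin (n + 1) → ℝ) (ε : Fin n → Bool) (pt qt : Fin n → ℝ → ℝ)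
    (i : Fin n) (t y z : ℝ) : F2 X Y Z ε pt qt i t y z = F1 X Z Y ε qt pt i t z y := by
  unfold F1 F2
  ring

lemma sub_e1_e0_ne_zero (hX : StrictMono X) (ε : Fin n → Bool) (i : Fin n) :
    X (e1 ε i) - X (e0 ε i) ≠ 0 := by
  have h := hX i.castSucc_lt_succ
  unfold e1 e0
  split_ifs
  · exact (sub_neg.2 h).ne
  · exact (sub_pos.2 h).ne'

lemma sub_last_zero_pos (hX : StrictMono X) (i : Fin n) : 0 < X (Fin.last n) - X 0 :=
  sub_pos.2 (hX ((Fin.zero_le _).trans_lt (Fin.castSucc_lt_last i)))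

lemma acoef_ne_zero (hX : StrictMono X) (ε : Fin n → Bool) (i : Fin n) : acoef X ε i ≠ 0 :=
  div_ne_zero (sub_e1_e0_ne_zero hX ε i) (sub_last_zero_pos hX i).ne'

lemma Lmap_Linv (hX : StrictMono X) (ε : Fin n → Bool) (i : Fin n) (t : ℝ) :
    Lmap X ε i (Linv X ε i t) = t := by
  unfold Lmap Linv
  rw [mul_div_cancel₀ _ (acoef_ne_zero hX ε i)]
  ring

lemma Linv_eq (hX : StrictMono X) (ε : Fin n → Bool) (i : Fin n) (t : ℝ) :
    Linv X ε i t =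
      X 0 + (t - X (e0 ε i)) / (X (e1 ε i) - X (e0 ε i)) * (X (Fin.last n) - X 0) := by
  have h1 := sub_e1_e0_ne_zero hX ε i
  have h2 := (sub_last_zero_pos hX i).ne'
  unfold Linv acoef bcoef
  field_simp
  ring

lemma Linv_mem_Ifull (hX : StrictMono X) (ε : Fin n → Bool) (i : Fin n) {t : ℝ}
    (ht : t ∈ Isub X i) : Linv X ε i t ∈ Ifull X := by
  have h := sub_pos.2 (hX i.castSucc_lt_succ)
  have h0 := sub_last_zero_pos hX i
  have key : 0 ≤ (t - X (e0 ε i)) / (X (e1 ε i) - X (e0 ε i)) ∧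
      (t - X (e0 ε i)) / (X (e1 ε i) - X (e0 ε i)) ≤ 1 := by
    obtain ⟨hl, hr⟩ := ht
    unfold e0 e1
    split_ifs
    · rw [← neg_div_neg_eq, neg_sub, neg_sub]
      exact ⟨div_nonneg (by linarith) h.le, (div_le_one h).2 (by linarith)⟩
    · exact ⟨div_nonneg (by linarith) h.le, (div_le_one h).2 (by linarith)⟩
  rw [Linv_eq hX]
  constructor
  · nlinarith [key.1]
  · nlinarith [key.2]

lemma Linv_e0 (hX : StrictMono X) (ε : Fin n → Bool) (i : Fin n) :
    Linv X ε i (X (e0 ε i)) = X 0 := by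
  simp [Linv_eq hX]

lemma Linv_e1 (hX : StrictMono X) (ε : Fin n → Bool) (i : Fin n) :
    Linv X ε i (X (e1 ε i)) = X (Fin.last n) := by
  rw [Linv_eq hX, div_self (sub_e1_e0_ne_zero hX ε i)]
  ring

lemma F1_zero (ε : Fin n → Bool) (p q : Fin n → ℝ → ℝ) (i : Fin n) :
    F1 X Y Z ε p q i (X 0) (Y 0) (Z 0) = Y (e0 ε i) := by
  simp [F1, base, mu]

lemma F1_last (hX : StrictMono X) (ε : Fin n → Bool) (p q : Fin n → ℝ → ℝ) (i : Fin n) :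
    F1 X Y Z ε p q i (X (Fin.last n)) (Y (Fin.last n)) (Z (Fin.last n)) = Y (e1 ε i) := by
  simp [F1, base, mu, div_self (sub_last_zero_pos hX i).ne']

/-- The first component of the Read operator interpolates `Y` at the ends of each `I_i`. -/
lemma F1_Linv_endpoints (hX : StrictMono X) {g1 g2 : ℝ → ℝ}
    (h10 : g1 (X 0) = Y 0) (h20 : g2 (X 0) = Z 0)
    (h1n : g1 (X (Fin.last n)) = Y (Fin.last n)) (h2n : g2 (X (Fin.last n)) = Z (Fin.last n))
    (ε : Fin n → Bool) (p q : Fin n → ℝ → ℝ) (i : Fin n) (j : Fin (n + 1))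
    (hj : j = i.castSucc ∨ j = i.succ) :
    F1 X Y Z ε p q i (Linv X ε i (X j)) (g1 (Linv X ε i (X j))) (g2 (Linv X ε i (X j))) = Y j := by
  have h : j = e0 ε i ∨ j = e1 ε i := by
    unfold e0 e1
    split_ifs
    · exact hj.symm
    · exact hj
  rcases h with rfl | rfl
  · rw [Linv_e0 hX, h10, h20, F1_zero]
  · rw [Linv_e1 hX, h1n, h2n, F1_last hX]

lemma continuousOn_F1_Linv (hX : StrictMono X) {g1 g2 : ℝ → ℝ} {i : Fin n}
    (hg1 : ContinuousOn g1 (Ifull X)) (hg2 : ContinuousOn g2 (Ifull X))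
    (hp : ContinuousOn (p i) (Isub X i)) (hq : ContinuousOn (q i) (Isub X i)) :
    ContinuousOn (fun t => F1 X Y Z ε p q i (Linv X ε i t) (g1 (Linv X ε i t))
      (g2 (Linv X ε i t))) (Isub X i) := by
  have hL : Continuous (Linv X ε i) := by
    unfold Linv
    fun_prop
  have hm : MapsTo (Linv X ε i) (Isub X i) (Ifull X) := fun _ ht => Linv_mem_Ifull hX ε i ht
  have hmu : Continuous (fun t => mu X (Linv X ε i t)) := by
    unfold mu
    fun_prop
  have hg1' := hg1.comp hL.continuousOn hm
  have hg2' := hg2.comp hL.continuousOn hm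
  simp only [Function.comp_def] at hg1' hg2'
  simp only [F1, base, Lmap_Linv hX]
  fun_prop

lemma exists_mem_Isub (hn : 0 < n) {t : ℝ} (ht : t ∈ Ifull X) : ∃ i, t ∈ Isub X i := by
  by_contra! h
  have hle : ∀ j, X j ≤ t := by
    intro j
    induction j using Fin.induction with
    | zero => exact ht.1
    | succ i ih => exact (not_le.1 fun hr => h i ⟨ih, hr⟩).le
  obtain ⟨m, rfl⟩ := Nat.exists_eq_succ_of_ne_zero hn.ne'
  exact h (Fin.last m) ⟨hle _, ht.2⟩

lemma Isub_subset_Ifull (hX : StrictMono X) (i : Fin n) : Isub X i ⊆ Ifull X :=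
  Icc_subset_Icc (hX.monotone (Fin.zero_le _)) (hX.monotone (Fin.le_last _))

/-- Continuous functions on the `I_i` that interpolate the same data glue to a continuous
function on `I`. -/
lemma exists_glue (hn : 0 < n) (hX : StrictMono X) (W : Fin (n + 1) → ℝ) (φ : Fin n → ℝ → ℝ)
    (hφ : ∀ i, ContinuousOn (φ i) (Isub X i))
    (hW : ∀ (i : Fin n) (j : Fin (n + 1)), j = i.castSucc ∨ j = i.succ → φ i (X j) = W j) :
    ∃ G : ℝ → ℝ, ContinuousOn G (Ifull X) ∧ (∀ i, EqOn G (φ i) (Isub X i)) ∧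
      G (X 0) = W 0 ∧ G (X (Fin.last n)) = W (Fin.last n) := by
  classical
  have lt_agree : ∀ i j t, i < j → t ∈ Isub X i → t ∈ Isub X j → φ i t = φ j t := by
    intro i j t hij hi hj
    have hle : i.succ ≤ j.castSucc := Fin.succ_le_castSucc_iff.2 hij
    have h1 : t = X i.succ := le_antisymm hi.2 ((hX.monotone hle).trans hj.1)
    have h2 : t = X j.castSucc := le_antisymm (hi.2.trans (hX.monotone hle)) hj.1
    have h3 : i.succ = j.castSucc := hX.injective (h1.symm.trans h2)
    rw [h1, hW i _ (Or.inr rfl), h3, hW j _ (Or.inl rfl)]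
  have agree : ∀ i j t, t ∈ Isub X i → t ∈ Isub X j → φ i t = φ j t := by
    intro i j t hi hj
    rcases lt_trichotomy i j with h | rfl | h
    · exact lt_agree i j t h hi hj
    · rfl
    · exact (lt_agree j i t h hj hi).symm
  let G : ℝ → ℝ := fun t => if h : ∃ i, t ∈ Isub X i then φ h.choose t else 0
  have hG : ∀ i, EqOn G (φ i) (Isub X i) := by
    intro i t ht
    have h : ∃ i, t ∈ Isub X i := ⟨i, ht⟩
    simp only [G, dif_pos h]
    exact agree _ _ _ h.choose_spec ht
  have hnode : ∀ (i : Fin n) (j : Fin (n + 1)), j = i.castSucc ∨ j = i.succ → G (X j) = W j := by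
    intro i j hj
    have hlt := (hX i.castSucc_lt_succ).le
    have hmem : X j ∈ Isub X i := by
      rcases hj with rfl | rfl
      · exact left_mem_Icc.2 hlt
      · exact right_mem_Icc.2 hlt
    rw [hG i hmem, hW i j hj]
  refine ⟨G, ?_, hG, ?_, ?_⟩
  · refine ((locallyFinite_of_finite (Isub X)).continuousOn_iUnion (fun _ => isClosed_Icc)
      fun i => (hφ i).congr (hG i)).mono fun t ht => mem_iUnion.2 (exists_mem_Isub hn ht)
  · exact hnode ⟨0, hn⟩ 0 (Or.inl rfl)
  · obtain ⟨m, rfl⟩ := Nat.exists_eq_succ_of_ne_zero hn.ne'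
    exact hnode (Fin.last m) _ (Or.inr rfl)

/-- The Read operator maps `C₀²(I)` to itself. -/
lemma exists_read_image (hn : 0 < n) (hyp : Hyps X p q pt qt) {g1 g2 : ℝ → ℝ}
    (hg1 : ContinuousOn g1 (Ifull X)) (hg2 : ContinuousOn g2 (Ifull X))
    (h10 : g1 (X 0) = Y 0) (h20 : g2 (X 0) = Z 0)
    (h1n : g1 (X (Fin.last n)) = Y (Fin.last n)) (h2n : g2 (X (Fin.last n)) = Z (Fin.last n)) :
    ∃ G1 G2 : ℝ → ℝ, ContinuousOn G1 (Ifull X) ∧ ContinuousOn G2 (Ifull X) ∧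
      G1 (X 0) = Y 0 ∧ G2 (X 0) = Z 0 ∧
      G1 (X (Fin.last n)) = Y (Fin.last n) ∧ G2 (X (Fin.last n)) = Z (Fin.last n) ∧
      ∀ i : Fin n, ∀ t ∈ Isub X i,
        G1 t = F1 X Y Z ε p q i (Linv X ε i t) (g1 (Linv X ε i t)) (g2 (Linv X ε i t)) ∧
        G2 t = F2 X Y Z ε pt qt i (Linv X ε i t) (g1 (Linv X ε i t)) (g2 (Linv X ε i t)) := by
  obtain ⟨hX, hp, hpt, hq, hqt, -, -⟩ := hyp
  have cont : ∀ {f : Fin n → ℝ → ℝ}, (∀ i, ∃ K : NNReal, LipschitzOnWith K (f i) (Isub X i)) →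
      ∀ i, ContinuousOn (f i) (Isub X i) := fun hf i => (hf i).choose_spec.continuousOn
  obtain ⟨G1, c1, eq1, l1, r1⟩ := exists_glue hn hX Y _
    (fun i => continuousOn_F1_Linv (Y := Y) (Z := Z) (ε := ε) hX hg1 hg2 (cont hp i) (cont hq i))
    (F1_Linv_endpoints hX h10 h20 h1n h2n ε p q)
  obtain ⟨G2, c2, eq2, l2, r2⟩ := exists_glue hn hX Z _
    (fun i => continuousOn_F1_Linv (Y := Z) (Z := Y) (ε := ε) hX hg2 hg1 (cont hqt i) (cont hpt i))
    (F1_Linv_endpoints hX h20 h10 h2n h1n ε qt pt)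
  refine ⟨G1, G2, c1, c2, l1, l2, r1, r2, fun i t ht => ⟨eq1 i ht, ?_⟩⟩
  rw [F2_eq_F1_swap]
  exact eq2 i ht

lemma abs_le_snormSub {i : Fin n} {g : ℝ → ℝ} (hg : ContinuousOn g (Isub X i)) {t : ℝ}
    (ht : t ∈ Isub X i) : |g t| ≤ snormSub X i g :=
  le_csSup (isCompact_Icc.image_of_continuousOn hg.abs).bddAbove ⟨t, ht, rfl⟩

lemma snormSub_nonneg (X : Fin (n + 1) → ℝ) (i : Fin n) (g : ℝ → ℝ) : 0 ≤ snormSub X i g :=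
  Real.sSup_nonneg (by rintro _ ⟨t, -, rfl⟩; exact abs_nonneg _)

lemma Sbar_nonneg (X : Fin (n + 1) → ℝ) (p q pt qt : Fin n → ℝ → ℝ) : 0 ≤ Sbar X p q pt qt :=
  Real.iSup_nonneg fun i =>
    le_max_of_le_left (add_nonneg (snormSub_nonneg X i _) (snormSub_nonneg X i _))

lemma Sbar_lt_one (hn : 0 < n) (hyp : Hyps X p q pt qt) : Sbar X p q pt qt < 1 := by
  have : Nonempty (Fin n) := ⟨⟨0, hn⟩⟩
  obtain ⟨-, -, -, -, -, h1, h2⟩ := hyp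
  unfold Sbar
  obtain ⟨i, hi⟩ := exists_eq_ciSup_of_finite (f := fun i : Fin n =>
    max (snormSub X i (p i) + snormSub X i (pt i)) (snormSub X i (q i) + snormSub X i (qt i)))
  rw [← hi]
  exact max_lt (h1 i) (h2 i)

lemma abs_read_sub_le (hyp : Hyps X p q pt qt) {g1 g2 h1 h2 : ℝ → ℝ} {M : ℝ}
    (hM : ∀ s ∈ Ifull X, |g1 s - h1 s| + |g2 s - h2 s| ≤ M) {i : Fin n} {t : ℝ}
    (ht : t ∈ Isub X i) :
    |F1 X Y Z ε p q i (Linv X ε i t) (g1 (Linv X ε i t)) (g2 (Linv X ε i t)) -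
        F1 X Y Z ε p q i (Linv X ε i t) (h1 (Linv X ε i t)) (h2 (Linv X ε i t))| +
      |F2 X Y Z ε pt qt i (Linv X ε i t) (g1 (Linv X ε i t)) (g2 (Linv X ε i t)) -
        F2 X Y Z ε pt qt i (Linv X ε i t) (h1 (Linv X ε i t)) (h2 (Linv X ε i t))| ≤
      Sbar X p q pt qt * M := by
  obtain ⟨hX, hp, hpt, hq, hqt, -, -⟩ := hyp
  have bound : ∀ {f : Fin n → ℝ → ℝ}, (∀ i, ∃ K : NNReal, LipschitzOnWith K (f i) (Isub X i)) →
      |f i t| ≤ snormSub X i (f i) :=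
    fun hf => abs_le_snormSub (hf i).choose_spec.continuousOn ht
  have hS : max (snormSub X i (p i) + snormSub X i (pt i))
      (snormSub X i (q i) + snormSub X i (qt i)) ≤ Sbar X p q pt qt :=
    le_ciSup (f := fun i : Fin n => max (snormSub X i (p i) + snormSub X i (pt i))
      (snormSub X i (q i) + snormSub X i (qt i))) (finite_range _).bddAbove i
  have hs := Linv_mem_Ifull hX ε i ht
  simp only [F1, F2, Lmap_Linv hX]
  set s := Linv X ε i t
  set u := g1 s - h1 s with hu
  set v := g2 s - h2 s with hv
  have tri : ∀ a b c d e : ℝ, |a * (g1 s - c) + b * (g2 s - d) + e -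
      (a * (h1 s - c) + b * (h2 s - d) + e)| ≤ |a| * |u| + |b| * |v| := by
    intro a b c d e
    rw [← abs_mul, ← abs_mul]
    refine le_of_eq_of_le (congrArg _ ?_) (abs_add_le _ _)
    rw [hu, hv]
    ring
  calc _ ≤ (|p i t| * |u| + |q i t| * |v|) + (|pt i t| * |u| + |qt i t| * |v|) :=
        add_le_add (tri _ _ _ _ _) (tri _ _ _ _ _)
    _ = (|p i t| + |pt i t|) * |u| + (|q i t| + |qt i t|) * |v| := by ring
    _ ≤ Sbar X p q pt qt * |u| + Sbar X p q pt qt * |v| := by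
        gcongr
        · exact (add_le_add (bound hp) (bound hpt)).trans ((le_max_left _ _).trans hS)
        · exact (add_le_add (bound hq) (bound hqt)).trans ((le_max_right _ _).trans hS)
    _ = Sbar X p q pt qt * (|u| + |v|) := by ring
    _ ≤ Sbar X p q pt qt * M := mul_le_mul_of_nonneg_left (hM s hs) (Sbar_nonneg X p q pt qt)

lemma le_sSup_dist {g1 g2 h1 h2 : ℝ → ℝ}
    (hg1 : ContinuousOn g1 (Ifull X)) (hg2 : ContinuousOn g2 (Ifull X))
    (hh1 : ContinuousOn h1 (Ifull X)) (hh2 : ContinuousOn h2 (Ifull X)) :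
    ∀ s ∈ Ifull X, |g1 s - h1 s| + |g2 s - h2 s| ≤
      sSup ((fun t => |g1 t - h1 t| + |g2 t - h2 t|) '' Ifull X) := fun s hs =>
  le_csSup (isCompact_Icc.image_of_continuousOn
    ((hg1.sub hh1).abs.add (hg2.sub hh2).abs)).bddAbove ⟨s, hs, rfl⟩

lemma sSup_read_le (hn : 0 < n) (hyp : Hyps X p q pt qt) {g1 g2 h1 h2 T1 T2 S1 S2 : ℝ → ℝ}
    (hg1 : ContinuousOn g1 (Ifull X)) (hg2 : ContinuousOn g2 (Ifull X))
    (hh1 : ContinuousOn h1 (Ifull X)) (hh2 : ContinuousOn h2 (Ifull X))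
    (hT : ∀ i : Fin n, ∀ t ∈ Isub X i,
      T1 t = F1 X Y Z ε p q i (Linv X ε i t) (g1 (Linv X ε i t)) (g2 (Linv X ε i t)) ∧
      T2 t = F2 X Y Z ε pt qt i (Linv X ε i t) (g1 (Linv X ε i t)) (g2 (Linv X ε i t)))
    (hS : ∀ i : Fin n, ∀ t ∈ Isub X i,
      S1 t = F1 X Y Z ε p q i (Linv X ε i t) (h1 (Linv X ε i t)) (h2 (Linv X ε i t)) ∧
      S2 t = F2 X Y Z ε pt qt i (Linv X ε i t) (h1 (Linv X ε i t)) (h2 (Linv X ε i t))) :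
    sSup ((fun t => |T1 t - S1 t| + |T2 t - S2 t|) '' Ifull X) ≤
      Sbar X p q pt qt * sSup ((fun t => |g1 t - h1 t| + |g2 t - h2 t|) '' Ifull X) := by
  have hne : (Ifull X).Nonempty := nonempty_Icc.2 (hyp.1.monotone (Fin.zero_le _))
  refine csSup_le (hne.image _) ?_
  rintro _ ⟨t, ht, rfl⟩
  obtain ⟨i, hi⟩ := exists_mem_Isub hn ht
  simp only [hT i t hi, hS i t hi]
  exact abs_read_sub_le hyp (le_sSup_dist hg1 hg2 hh1 hh2) hi

lemma IsFixedPt.eqOn (hn : 0 < n) (hyp : Hyps X p q pt qt) {f1 f2 g1 g2 : ℝ → ℝ}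
    (hf : IsFixedPt X Y Z ε p q pt qt f1 f2) (hg : IsFixedPt X Y Z ε p q pt qt g1 g2) :
    ∀ t ∈ Ifull X, f1 t = g1 t ∧ f2 t = g2 t := by
  obtain ⟨cf1, cf2, -, -, -, -, ef⟩ := hf
  obtain ⟨cg1, cg2, -, -, -, -, eg⟩ := hg
  intro t ht
  have hD := sSup_read_le hn hyp cf1 cf2 cg1 cg2 ef eg
  have hle := le_sSup_dist cf1 cf2 cg1 cg2 t ht
  have hlt := Sbar_lt_one hn hyp
  have h1 := abs_nonneg (f1 t - g1 t)
  have h2 := abs_nonneg (f2 t - g2 t)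
  have h0 : |f1 t - g1 t| + |f2 t - g2 t| ≤ 0 := by nlinarith
  exact ⟨sub_eq_zero.1 (abs_eq_zero.1 (by linarith)), sub_eq_zero.1 (abs_eq_zero.1 (by linarith))⟩

/-- The space `C₀²(I)`, as a set of continuous maps into `ℝ²` with the `ℓ¹` norm. -/
def boundaryPairs (X Y Z : Fin (n + 1) → ℝ) :
    Set C(Icc (X 0) (X (Fin.last n)), WithLp 1 (ℝ × ℝ)) :=
  {g | ∀ t : Icc (X 0) (X (Fin.last n)), ((t : ℝ) = X 0 → g t = toLp 1 (Y 0, Z 0)) ∧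
    ((t : ℝ) = X (Fin.last n) → g t = toLp 1 (Y (Fin.last n), Z (Fin.last n)))}

lemma isClosed_boundaryPairs (X Y Z : Fin (n + 1) → ℝ) : IsClosed (boundaryPairs X Y Z) := by
  simp only [boundaryPairs, ofPred_forall, ofPred_and]
  exact isClosed_iInter fun t => (isClosed_iInter fun _ =>
    isClosed_eq (continuous_eval_const t) continuous_const).inter (isClosed_iInter fun _ =>
    isClosed_eq (continuous_eval_const t) continuous_const)

lemma boundaryPairs_iccExtend (hle : X 0 ≤ X (Fin.last n))
    {g : C(Icc (X 0) (X (Fin.last n)), WithLp 1 (ℝ × ℝ))} (hg : g ∈ boundaryPairs X Y Z) :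
    ContinuousOn (fun t => (IccExtend hle g t).fst) (Ifull X) ∧
      ContinuousOn (fun t => (IccExtend hle g t).snd) (Ifull X) ∧
      (IccExtend hle g (X 0)).fst = Y 0 ∧ (IccExtend hle g (X 0)).snd = Z 0 ∧
      (IccExtend hle g (X (Fin.last n))).fst = Y (Fin.last n) ∧
      (IccExtend hle g (X (Fin.last n))).snd = Z (Fin.last n) := by
  have hc : Continuous (IccExtend hle g) := g.continuous.Icc_extend'
  have h0 := (hg ⟨X 0, left_mem_Icc.2 hle⟩).1 rfl
  have hl := (hg ⟨X (Fin.last n), right_mem_Icc.2 hle⟩).2 rfl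
  exact ⟨((WithLp.continuous_fst 1 ℝ ℝ).comp hc).continuousOn,
    ((WithLp.continuous_snd 1 ℝ ℝ).comp hc).continuousOn,
    by simp [h0], by simp [h0], by simp [hl], by simp [hl]⟩

/-- The element of `boundaryPairs` given by two functions on `ℝ`. -/
def boundaryPairs.mk {g1 g2 : ℝ → ℝ}
    (hg1 : ContinuousOn g1 (Ifull X)) (hg2 : ContinuousOn g2 (Ifull X))
    (h10 : g1 (X 0) = Y 0) (h20 : g2 (X 0) = Z 0)
    (h1n : g1 (X (Fin.last n)) = Y (Fin.last n)) (h2n : g2 (X (Fin.last n)) = Z (Fin.last n)) :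
    boundaryPairs X Y Z :=
  ⟨⟨fun t => toLp 1 (g1 t, g2 t), (prod_continuous_toLp 1 ℝ ℝ).comp
      (hg1.domRestrict.prodMk hg2.domRestrict)⟩, fun t =>
    ⟨fun ht => by simp [ht, h10, h20], fun ht => by simp [ht, h1n, h2n]⟩⟩

lemma exists_read_boundaryPairs (hn : 0 < n) (hyp : Hyps X p q pt qt)
    (hle : X 0 ≤ X (Fin.last n)) (g : boundaryPairs X Y Z) :
    ∃ G : boundaryPairs X Y Z, ∀ i : Fin n, ∀ t ∈ Isub X i,
      (IccExtend hle G.1 t).fst = F1 X Y Z ε p q i (Linv X ε i t)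
        (IccExtend hle g.1 (Linv X ε i t)).fst (IccExtend hle g.1 (Linv X ε i t)).snd ∧
      (IccExtend hle G.1 t).snd = F2 X Y Z ε pt qt i (Linv X ε i t)
        (IccExtend hle g.1 (Linv X ε i t)).fst (IccExtend hle g.1 (Linv X ε i t)).snd := by
  obtain ⟨c1, c2, l1, l2, r1, r2⟩ := boundaryPairs_iccExtend hle g.2
  obtain ⟨G1, G2, C1, C2, L1, L2, R1, R2, hG⟩ := exists_read_image (ε := ε) (Y := Y) (Z := Z)
    (g1 := fun t => (IccExtend hle g.1 t).fst) (g2 := fun t => (IccExtend hle g.1 t).snd) hn hyp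
    c1 c2 l1 l2 r1 r2
  refine ⟨boundaryPairs.mk C1 C2 L1 L2 R1 R2, fun i t ht => ?_⟩
  rw [IccExtend_of_mem hle _ (Isub_subset_Ifull hyp.1 i ht)]
  exact hG i t ht

lemma exists_isFixedPt (hn : 0 < n) (hyp : Hyps X p q pt qt) :
    ∃ f1 f2 : ℝ → ℝ, IsFixedPt X Y Z ε p q pt qt f1 f2 := by
  have hX := hyp.1
  have hle : X 0 ≤ X (Fin.last n) := hX.monotone (Fin.zero_le _)
  have hpos := sub_last_zero_pos hX ⟨0, hn⟩
  have : CompleteSpace (boundaryPairs X Y Z) :=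
    (isClosed_boundaryPairs X Y Z).completeSpace_coe
  have hbase : ∀ W, ContinuousOn (base X W) (Ifull X) := fun W => by
    unfold base mu
    fun_prop
  have : Nonempty (boundaryPairs X Y Z) :=
    ⟨boundaryPairs.mk (hbase Y) (hbase Z) (by simp [base, mu]) (by simp [base, mu])
      (by simp [base, mu, div_self hpos.ne']) (by simp [base, mu, div_self hpos.ne'])⟩
  choose T hT using exists_read_boundaryPairs (Y := Y) (Z := Z) (ε := ε) hn hyp hle
  have hcontr : ContractingWith ⟨Sbar X p q pt qt, Sbar_nonneg X p q pt qt⟩ T := by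
    refine ⟨Sbar_lt_one hn hyp, LipschitzWith.of_dist_le_mul fun g h => ?_⟩
    refine (ContinuousMap.dist_le (mul_nonneg (Sbar_nonneg X p q pt qt) dist_nonneg)).2 fun t => ?_
    obtain ⟨i, hi⟩ := exists_mem_Isub hn t.2
    have hb := abs_read_sub_le (Y := Y) (Z := Z) (ε := ε) hyp (M := dist g h)
      (g1 := fun t => (IccExtend hle g.1 t).fst) (g2 := fun t => (IccExtend hle g.1 t).snd)
      (h1 := fun t => (IccExtend hle h.1 t).fst) (h2 := fun t => (IccExtend hle h.1 t).snd)
      (fun s _ => by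
        have := ContinuousMap.dist_apply_le_dist (f := g.1) (g := h.1) (projIcc _ _ hle s)
        rwa [prod_dist_eq_of_L1] at this) hi
    rw [← (hT g i t hi).1, ← (hT g i t hi).2, ← (hT h i t hi).1, ← (hT h i t hi).2,
      IccExtend_val, IccExtend_val] at hb
    rw [prod_dist_eq_of_L1]
    exact hb
  obtain ⟨f, hf⟩ : ∃ f, T f = f := ⟨_, hcontr.fixedPoint_isFixedPt⟩
  obtain ⟨c1, c2, l1, l2, r1, r2⟩ := boundaryPairs_iccExtend hle f.2
  refine ⟨_, _, c1, c2, l1, l2, r1, r2, ?_⟩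
  have h := hT f
  rwa [hf] at h

end ReadOperator

end ZHV

/-- `T` is a contraction on `C₀²(I)` with ratio `S̄` for the metric
`D(g,h) = max_{x∈I}(|g₁-h₁| + |g₂-h₂|)`, and consequently has a unique fixed point. -/
theorem statement6 {n : ℕ} (hn : 0 < n) (X Y Z : Fin (n + 1) → ℝ) (ε : Fin n → Bool)
    (p q pt qt : Fin n → ℝ → ℝ) (hyp : Hyps X p q pt qt) :
    (∀ g1 g2 h1 h2 T1 T2 S1 S2 : ℝ → ℝ,
      ContinuousOn g1 (Ifull X) → ContinuousOn g2 (Ifull X) →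
      g1 (X 0) = Y 0 → g2 (X 0) = Z 0 →
      g1 (X (Fin.last n)) = Y (Fin.last n) → g2 (X (Fin.last n)) = Z (Fin.last n) →
      ContinuousOn h1 (Ifull X) → ContinuousOn h2 (Ifull X) →
      h1 (X 0) = Y 0 → h2 (X 0) = Z 0 →
      h1 (X (Fin.last n)) = Y (Fin.last n) → h2 (X (Fin.last n)) = Z (Fin.last n) →
      (∀ i : Fin n, ∀ t ∈ Isub X i,
        T1 t = F1 X Y Z ε p q i (Linv X ε i t)
            (g1 (Linv X ε i t)) (g2 (Linv X ε i t)) ∧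
        T2 t = F2 X Y Z ε pt qt i (Linv X ε i t)
            (g1 (Linv X ε i t)) (g2 (Linv X ε i t))) →
      (∀ i : Fin n, ∀ t ∈ Isub X i,
        S1 t = F1 X Y Z ε p q i (Linv X ε i t)
            (h1 (Linv X ε i t)) (h2 (Linv X ε i t)) ∧
        S2 t = F2 X Y Z ε pt qt i (Linv X ε i t)
            (h1 (Linv X ε i t)) (h2 (Linv X ε i t))) →
      sSup ((fun t => |T1 t - S1 t| + |T2 t - S2 t|) '' Ifull X) ≤
        Sbar X p q pt qt *
          sSup ((fun t => |g1 t - h1 t| + |g2 t - h2 t|) '' Ifull X)) ∧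
    (∃ f1 f2 : ℝ → ℝ, IsFixedPt X Y Z ε p q pt qt f1 f2 ∧
      ∀ f1' f2' : ℝ → ℝ, IsFixedPt X Y Z ε p q pt qt f1' f2' →
        ∀ t ∈ Ifull X, f1' t = f1 t ∧ f2' t = f2 t) := by
  refine ⟨?_, ?_⟩
  · intro g1 g2 h1 h2 T1 T2 S1 S2 hg1 hg2 _ _ _ _ hh1 hh2 _ _ _ _ hT hS
    exact sSup_read_le hn hyp hg1 hg2 hh1 hh2 hT hS
  · obtain ⟨f1, f2, hf⟩ := exists_isFixedPt (Y := Y) (Z := Z) (ε := ε) hn hyp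
    exact ⟨f1, f2, hf, fun _ _ hf' => hf'.eqOn hn hyp hf⟩
end

section
/- Fix i ∈ {1,…,n} and suppose p_i(x) < 0 and q_i(x) < 0 for all x ∈ I_i. If p_i^min > -min{(min{y_{i-1},y_i} - k_1)/(k_2 - min{y_0,y_n}), (k_2 - max{y_{i-1},y_i})/(max{y_0,y_n} - k_1)} and q_i^min ≥ -min{[(min{y_{i-1},y_i} - k_1) + p_i^min(k_2 - min{y_0,y_n})]/(k̃_2 - min{z_0,z_n}), [(k_2 - max{y_{i-1},y_i}) + p_i^min(max{y_0,y_n} - k_1)]/(max{z_0,z_n} - k̃_1)}, then k_1 ≤ F_{i,1}(x,y,z) ≤ k_2 for every (x,y,z) ∈ I × [k_1,k_2] × [k̃_1,k̃_2]. -/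
open Set

open ZHV Set

namespace ZHV

variable {n : ℕ}

lemma mu_mem_Icc {X : Fin (n + 1) → ℝ} (h : X 0 < X (Fin.last n)) {t : ℝ} (ht : t ∈ Ifull X) :
    mu X t ∈ Icc (0 : ℝ) 1 := by
  have hpos : 0 < X (Fin.last n) - X 0 := sub_pos.2 h
  exact ⟨div_nonneg (sub_nonneg.2 ht.1) hpos.le,
    (div_le_one hpos).2 (sub_le_sub_right ht.2 _)⟩

lemma Lmap_eq {X : Fin (n + 1) → ℝ} (h : X 0 < X (Fin.last n)) (ε : Fin n → Bool) (i : Fin n)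
    (t : ℝ) : Lmap X ε i t = mu X t * X (e1 ε i) + (1 - mu X t) * X (e0 ε i) := by
  have hne : X (Fin.last n) - X 0 ≠ 0 := (sub_pos.2 h).ne'
  simp only [Lmap, acoef, bcoef, mu]
  field_simp
  ring

lemma convexComb_mem_Icc {s a b l u : ℝ} (hs : s ∈ Icc (0 : ℝ) 1) (ha : a ∈ Icc l u)
    (hb : b ∈ Icc l u) : s * a + (1 - s) * b ∈ Icc l u :=
  convex_Icc l u ha hb hs.1 (sub_nonneg.2 hs.2) (add_sub_cancel _ _)

lemma convexComb_endpoints_mem_Icc {s l u : ℝ} (hs : s ∈ Icc (0 : ℝ) 1) (W : Fin (n + 1) → ℝ)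
    (ε : Fin n → Bool) (i : Fin n) (h0 : W i.castSucc ∈ Icc l u) (h1 : W i.succ ∈ Icc l u) :
    s * W (e1 ε i) + (1 - s) * W (e0 ε i) ∈ Icc l u := by
  apply convexComb_mem_Icc hs
  · unfold e1; split_ifs <;> assumption
  · unfold e0; split_ifs <;> assumption

lemma Lmap_mem_Isub {X : Fin (n + 1) → ℝ} (hX : StrictMono X) (h : X 0 < X (Fin.last n))
    (ε : Fin n → Bool) (i : Fin n) {t : ℝ} (ht : t ∈ Ifull X) : Lmap X ε i t ∈ Isub X i := by
  have hle : X i.castSucc ≤ X i.succ := (hX i.castSucc_lt_succ).le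
  rw [Lmap_eq h]
  exact convexComb_endpoints_mem_Icc (mu_mem_Icc h ht) X ε i (left_mem_Icc.2 hle)
    (right_mem_Icc.2 hle)

lemma base_mem_Icc {X : Fin (n + 1) → ℝ} (h : X 0 < X (Fin.last n)) (W : Fin (n + 1) → ℝ)
    {t : ℝ} (ht : t ∈ Ifull X) :
    base X W t ∈ Icc (min (W 0) (W (Fin.last n))) (max (W 0) (W (Fin.last n))) :=
  convexComb_mem_Icc (mu_mem_Icc h ht) ⟨min_le_right _ _, le_max_right _ _⟩
    ⟨min_le_left _ _, le_max_left _ _⟩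

lemma fmin_le {X : Fin (n + 1) → ℝ} {i : Fin n} {g : ℝ → ℝ} (hg : ContinuousOn g (Isub X i))
    {t : ℝ} (ht : t ∈ Isub X i) : fmin X i g ≤ g t :=
  csInf_le (isCompact_Icc.image_of_continuousOn hg).bddBelow (mem_image_of_mem g ht)

/-- Bounds for `c * (v - b)` when `c₀ ≤ c ≤ 0`, `v ∈ [l, u]` and `b ∈ [m, M]`. -/
lemma nonpos_mul_sub_mem_Icc {c₀ c v b l u m M : ℝ} (hc₀ : c₀ ≤ c) (hc : c ≤ 0)
    (hv : v ∈ Icc l u) (hb : b ∈ Icc m M) (hm : m ≤ u) (hM : l ≤ M) :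
    c * (v - b) ∈ Icc (c₀ * (u - m)) (-(c₀ * (M - l))) := by
  obtain ⟨hl, hu⟩ := hv
  obtain ⟨hbm, hbM⟩ := hb
  constructor
  · exact (mul_le_mul_of_nonneg_right hc₀ (sub_nonneg.2 hm)).trans
      (mul_le_mul_of_nonpos_left (by linarith) hc)
  · have h₁ : c * (v - b) ≤ c * (l - M) := mul_le_mul_of_nonpos_left (by linarith) hc
    have h₂ : c₀ * (M - l) ≤ c * (M - l) := mul_le_mul_of_nonneg_right hc₀ (sub_nonneg.2 hM)
    linarith

lemma neg_le_mul_of_neg_div_le {a d c : ℝ} (hd : 0 < d) (h : -(a / d) ≤ c) : -a ≤ c * d := by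
  rwa [← neg_div, div_le_iff₀ hd] at h

end ZHV

/-- Case 2 of Theorem 3. If `p_i, q_i < 0` on `I_i` and `p_i^min`,
`q_i^min` satisfy the stated bounds, then `k₁ ≤ F_{i,1}(x,y,z) ≤ k₂` on
`I × [k₁,k₂] × [k̃₁,k̃₂]`. -/
theorem statement11 {n : ℕ} (hn : 0 < n) (X Y Z : Fin (n + 1) → ℝ) (ε : Fin n → Bool)
    (p q pt qt : Fin n → ℝ → ℝ) (hyp : Hyps X p q pt qt)
    (k1 k2 kt1 kt2 : ℝ)
    (hk1 : ∀ j, k1 < Y j) (hk2 : ∀ j, Y j < k2)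
    (hkt1 : ∀ j, kt1 < Z j) (hkt2 : ∀ j, Z j < kt2)
    (i : Fin n)
    (hsign : ∀ t ∈ Isub X i, p i t < 0 ∧ q i t < 0)
    (hp : fmin X i (p i) > -min
      ((min (Y i.castSucc) (Y i.succ) - k1) / (k2 - min (Y 0) (Y (Fin.last n))))
      ((k2 - max (Y i.castSucc) (Y i.succ)) / (max (Y 0) (Y (Fin.last n)) - k1)))
    (hq : fmin X i (q i) ≥ -min
      (((min (Y i.castSucc) (Y i.succ) - k1)
          + fmin X i (p i) * (k2 - min (Y 0) (Y (Fin.last n)))) /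
        (kt2 - min (Z 0) (Z (Fin.last n))))
      (((k2 - max (Y i.castSucc) (Y i.succ))
          + fmin X i (p i) * (max (Y 0) (Y (Fin.last n)) - k1)) /
        (max (Z 0) (Z (Fin.last n)) - kt1))) :
    ∀ t ∈ Ifull X, ∀ yv ∈ Icc k1 k2, ∀ zv ∈ Icc kt1 kt2,
      F1 X Y Z ε p q i t yv zv ∈ Icc k1 k2 := by
  intro t ht yv hyv zv hzv
  obtain ⟨hX, hpL, -, hqL, -, -, -⟩ := hyp
  obtain ⟨Kp, hpK⟩ := hpL i
  obtain ⟨Kq, hqK⟩ := hqL i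
  have h0n : X 0 < X (Fin.last n) := hX (by simpa [Fin.lt_def] using hn)
  have hL := Lmap_mem_Isub hX h0n ε i ht
  have hmY : min (Y 0) (Y (Fin.last n)) < k2 := min_lt_of_left_lt (hk2 0)
  have hMY : k1 < max (Y 0) (Y (Fin.last n)) := lt_max_of_lt_left (hk1 0)
  have hmZ : min (Z 0) (Z (Fin.last n)) < kt2 := min_lt_of_left_lt (hkt2 0)
  have hMZ : kt1 < max (Z 0) (Z (Fin.last n)) := lt_max_of_lt_left (hkt1 0)
  obtain ⟨hp₁, hp₂⟩ := nonpos_mul_sub_mem_Icc (fmin_le hpK.continuousOn hL) (hsign _ hL).1.le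
    hyv (base_mem_Icc h0n Y ht) hmY.le hMY.le
  obtain ⟨hq₁, hq₂⟩ := nonpos_mul_sub_mem_Icc (fmin_le hqK.continuousOn hL) (hsign _ hL).2.le
    hzv (base_mem_Icc h0n Z ht) hmZ.le hMZ.le
  obtain ⟨he₁, he₂⟩ := convexComb_endpoints_mem_Icc (mu_mem_Icc h0n ht) Y ε i
    ⟨min_le_left _ _, le_max_left _ _⟩ ⟨min_le_right _ _, le_max_right _ _⟩
  have hlow := neg_le_mul_of_neg_div_le (sub_pos.2 hmZ)
    ((neg_le_neg (min_le_left _ _)).trans hq)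
  have hupp := neg_le_mul_of_neg_div_le (sub_pos.2 hMZ)
    ((neg_le_neg (min_le_right _ _)).trans hq)
  constructor <;> unfold F1 <;> linarith
end

section
/- Let piecewise lines y = m_i x + b_{i1} and y = m_i x + b_{i2} enclose the data at constant vertical gaps: y_{i-1+ε_i} - m_i x_{i-1+ε_i} - b_{i1} = y_0 - m_1 x_0 - b_{11} > 0 and m_i x_{i-1+ε_i} + b_{i2} - y_{i-1+ε_i} = m_1 x_0 + b_{12} - y_0 > 0 for all i, where m_i = (y_i - y_{i-1})/(x_i - x_{i-1}). Fix i ∈ {1,…,n} and suppose p_i(x) ≥ 0 and q_i(x) ≥ 0 for all x ∈ I_i. If p_i^max ≤ min{(y_0 - m_1 x_0 - b_{11})/(max{y_0,y_n} - y_min), (m_1 x_0 + b_{12} - y_0)/(y_max - min{y_0,y_n})} and q_i^max ≤ min{[(y_0 - m_1 x_0 - b_{11}) - p_i^max(max{y_0,y_n} - y_min)]/(max{z_0,z_n} + k̃), [(m_1 x_0 + b_{12} - y_0) - p_i^max(y_max - min{y_0,y_n})]/(k̃ - min{z_0,z_n})}, then m_i L_i(x) + b_{i1} ≤ F_{i,1}(x,y,z)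 ≤ m_i L_i(x) + b_{i2} for every x ∈ I, y ∈ [y_min, y_max] and z ∈ [-k̃, k̃]. -/
open Set

open ZHV Set

theorem ZHV.mu_mem_Icc_s19 {n : ℕ} {X : Fin (n + 1) → ℝ} {t : ℝ} (ht : t ∈ Ifull X) :
    mu X t ∈ Icc (0 : ℝ) 1 := by
  obtain ⟨h0, h1⟩ := ht
  refine ⟨div_nonneg (by linarith) (by linarith), div_le_one_of_le₀ (by linarith) (by linarith)⟩

theorem ZHV.Lmap_eq_mu {n : ℕ} {X : Fin (n + 1) → ℝ} (hX : X 0 < X (Fin.last n))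
    (ε : Fin n → Bool) (i : Fin n) (t : ℝ) :
    Lmap X ε i t = mu X t * X (e1 ε i) + (1 - mu X t) * X (e0 ε i) := by
  have h : X (Fin.last n) - X 0 ≠ 0 := by linarith
  unfold Lmap acoef bcoef mu
  field_simp
  ring

theorem ZHV.Lmap_mem_Isub_s19 {n : ℕ} {X : Fin (n + 1) → ℝ} (hX : StrictMono X)
    (hX0 : X 0 < X (Fin.last n)) (ε : Fin n → Bool) (i : Fin n) {t : ℝ} (ht : t ∈ Ifull X) :
    Lmap X ε i t ∈ Isub X i := by
  obtain ⟨h0, h1⟩ := mu_mem_Icc_s19 ht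
  have hlt : X i.castSucc < X i.succ := hX i.castSucc_lt_succ
  rw [Lmap_eq_mu hX0]
  unfold e0 e1 Isub
  split_ifs <;> constructor <;> nlinarith

/-- The data segment over `I_i` has slope `m_i`. -/
theorem ZHV.mslope_mul_sub {n : ℕ} {X : Fin (n + 1) → ℝ} (hX : StrictMono X)
    (Y : Fin (n + 1) → ℝ) (ε : Fin n → Bool) (i : Fin n) :
    mslope X Y i * (X (e1 ε i) - X (e0 ε i)) = Y (e1 ε i) - Y (e0 ε i) := by
  have h : X i.succ - X i.castSucc ≠ 0 := (sub_pos.2 (hX i.castSucc_lt_succ)).ne'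
  unfold mslope e0 e1
  split_ifs
  · field_simp
    ring
  · field_simp

theorem ZHV.base_mem_Icc_s19 {n : ℕ} {X : Fin (n + 1) → ℝ} (W : Fin (n + 1) → ℝ) {t : ℝ}
    (ht : t ∈ Ifull X) :
    base X W t ∈ Icc (min (W 0) (W (Fin.last n))) (max (W 0) (W (Fin.last n))) := by
  obtain ⟨h0, h1⟩ := mu_mem_Icc_s19 ht
  have a := min_le_left (W 0) (W (Fin.last n))
  have b := min_le_right (W 0) (W (Fin.last n))
  have c := le_max_left (W 0) (W (Fin.last n))
  have d := le_max_right (W 0) (W (Fin.last n))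
  unfold base
  constructor <;> nlinarith

theorem ZHV.le_fmax {n : ℕ} {X : Fin (n + 1) → ℝ} {i : Fin n} {g : ℝ → ℝ}
    (hg : ContinuousOn g (Isub X i)) {s : ℝ} (hs : s ∈ Isub X i) : g s ≤ fmax X i g :=
  le_csSup (isCompact_Icc.image_of_continuousOn hg).bddAbove (mem_image_of_mem g hs)

theorem mul_le_of_le_div_of_nonneg {r R D c : ℝ} (hr : 0 ≤ r) (hrR : r ≤ R) (hc : 0 ≤ c)
    (h : R ≤ c / D) : r * D ≤ c := by
  rcases le_or_gt D 0 with hD | hD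
  · exact (mul_nonpos_of_nonneg_of_nonpos hr hD).trans hc
  · exact (le_div_iff₀ hD).1 (hrR.trans h)

/-- Scaling factors obeying the two successive bounds use up at most the gap `d`. -/
theorem mul_add_mul_le_of_le_div {r R s S A B d u v : ℝ} (hr : 0 ≤ r) (hrR : r ≤ R)
    (hs : 0 ≤ s) (hsS : s ≤ S) (hA : 0 ≤ A) (hd : 0 ≤ d) (hR : R ≤ d / A)
    (hS : S ≤ (d - R * A) / B) (hu : u ≤ A) (hv : v ≤ B) : r * u + s * v ≤ d := by
  have h1 : R * A ≤ d := mul_le_of_le_div_of_nonneg (hr.trans hrR) le_rfl hd hR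
  have h2 : s * B ≤ d - R * A := mul_le_of_le_div_of_nonneg hs hsS (sub_nonneg.2 h1) hS
  have h3 : r * u ≤ r * A := mul_le_mul_of_nonneg_left hu hr
  have h4 : r * A ≤ R * A := mul_le_mul_of_nonneg_right hrR hA
  have h5 : s * v ≤ s * B := mul_le_mul_of_nonneg_left hv hs
  linarith

/-- Case 1 of Theorem 7. If the two families of lines enclose the
data at constant vertical gaps, `p_i, q_i ≥ 0` on `I_i`, and `p_i^max`, `q_i^max`
satisfy the stated bounds, then
`m_i L_i(x) + b_{i1} ≤ F_{i,1}(x,y,z) ≤ m_i L_i(x) + b_{i2}` for all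
`x ∈ I`, `y ∈ [y_min, y_max]`, `z ∈ [-k̃, k̃]`. -/
theorem statement19 {n : ℕ} (hn : 0 < n) (X Y Z : Fin (n + 1) → ℝ) (ε : Fin n → Bool)
    (p q pt qt : Fin n → ℝ → ℝ) (hyp : Hyps X p q pt qt)
    (ω : ℝ) (hω : Sbar X p q pt qt < ω) (hω1 : ω < 1)
    (b1 b2 : Fin n → ℝ)
    (i0 iN : Fin n) (hi0 : (i0 : ℕ) = 0) (hiN : (iN : ℕ) = n - 1)
    -- the constant vertical gaps
    (d1 d2 : ℝ)
    (hd1 : d1 = Y 0 - mslope X Y i0 * X 0 - b1 i0) (hd10 : 0 < d1)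
    (hgap1 : ∀ i, Y (e0 ε i) - mslope X Y i * X (e0 ε i) - b1 i = d1)
    (hd2 : d2 = mslope X Y i0 * X 0 + b2 i0 - Y 0) (hd20 : 0 < d2)
    (hgap2 : ∀ i, mslope X Y i * X (e0 ε i) + b2 i - Y (e0 ε i) = d2)
    -- abbreviations
    (ymin ymax ktil ymn ymx zmn zmx : ℝ)
    (hymin : ymin = min (⨅ i : Fin n, (mslope X Y i * X i.castSucc + b1 i))
      (mslope X Y iN * X (Fin.last n) + b1 iN))
    (hymax : ymax = max (⨆ i : Fin n, (mslope X Y i * X i.castSucc + b2 i))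
      (mslope X Y iN * X (Fin.last n) + b2 iN))
    (hktil : ktil = ((⨆ j, |Y j + Z j|)
        - ω * min |Y 0 + Z 0| |Y (Fin.last n) + Z (Fin.last n)|
        - (1 - ω) * ymin) / (1 - ω))
    (hymn : ymn = min (Y 0) (Y (Fin.last n))) (hymx : ymx = max (Y 0) (Y (Fin.last n)))
    (hzmn : zmn = min (Z 0) (Z (Fin.last n))) (hzmx : zmx = max (Z 0) (Z (Fin.last n)))
    (i : Fin n)
    (hsign : ∀ t ∈ Isub X i, 0 ≤ p i t ∧ 0 ≤ q i t)
    -- the conditions on the vertical scaling factors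
    (hp : fmax X i (p i) ≤ min (d1 / (ymx - ymin)) (d2 / (ymax - ymn)))
    (hq : fmax X i (q i) ≤ min
      ((d1 - fmax X i (p i) * (ymx - ymin)) / (zmx + ktil))
      ((d2 - fmax X i (p i) * (ymax - ymn)) / (ktil - zmn))) :
    ∀ t ∈ Ifull X, ∀ yv ∈ Icc ymin ymax, ∀ zv ∈ Icc (-ktil) ktil,
      mslope X Y i * Lmap X ε i t + b1 i ≤ F1 X Y Z ε p q i t yv zv ∧
      F1 X Y Z ε p q i t yv zv ≤ mslope X Y i * Lmap X ε i t + b2 i := by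
  obtain ⟨hX, hpL, -, hqL, -⟩ := hyp
  have hX0 : X 0 < X (Fin.last n) := hX (Fin.lt_def.2 (by simpa using hn))
  have hi0' : i0.castSucc = 0 := Fin.ext (by simpa using hi0)
  have hymin0 : ymin ≤ Y 0 := by
    have h := ciInf_le (finite_range fun i : Fin n ↦
      mslope X Y i * X i.castSucc + b1 i).bddBelow i0
    simp only [hi0'] at h
    rw [hymin]
    exact (min_le_left _ _).trans (by linarith)
  have hymax0 : Y 0 ≤ ymax := by
    have h := le_ciSup (finite_range fun i : Fin n ↦
      mslope X Y i * X i.castSucc + b2 i).bddAbove i0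
    simp only [hi0'] at h
    rw [hymax]
    exact le_trans (by linarith) (le_max_left _ _)
  have hymn0 : ymn ≤ Y 0 := hymn ▸ min_le_left _ _
  have hymx0 : Y 0 ≤ ymx := hymx ▸ le_max_left _ _
  intro t ht yv hy zv hz
  have hL := Lmap_mem_Isub_s19 hX hX0 ε i ht
  obtain ⟨hp0, hq0⟩ := hsign _ hL
  obtain ⟨Kp, hKp⟩ := hpL i
  obtain ⟨Kq, hKq⟩ := hqL i
  have hpm := le_fmax hKp.continuousOn hL
  have hqm := le_fmax hKq.continuousOn hL
  obtain ⟨hY1, hY2⟩ := base_mem_Icc_s19 Y ht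
  obtain ⟨hZ1, hZ2⟩ := base_mem_Icc_s19 Z ht
  rw [← hymn] at hY1
  rw [← hymx] at hY2
  rw [← hzmn] at hZ1
  rw [← hzmx] at hZ2
  obtain ⟨hy1, hy2⟩ := hy
  obtain ⟨hz1, hz2⟩ := hz
  have hlow : p i (Lmap X ε i t) * (base X Y t - yv) + q i (Lmap X ε i t) * (base X Z t - zv)
      ≤ d1 :=
    mul_add_mul_le_of_le_div hp0 hpm hq0 hqm (by linarith) hd10.le (hp.trans (min_le_left _ _))
      (hq.trans (min_le_left _ _)) (by linarith) (by linarith)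
  have hupp : p i (Lmap X ε i t) * (yv - base X Y t) + q i (Lmap X ε i t) * (zv - base X Z t)
      ≤ d2 :=
    mul_add_mul_le_of_le_div hp0 hpm hq0 hqm (by linarith) hd20.le (hp.trans (min_le_right _ _))
      (hq.trans (min_le_right _ _)) (by linarith) (by linarith)
  have hseg : mslope X Y i * Lmap X ε i t = mslope X Y i * X (e0 ε i)
      + (mu X t * Y (e1 ε i) + (1 - mu X t) * Y (e0 ε i)) - Y (e0 ε i) := by
    rw [Lmap_eq_mu hX0]
    linear_combination mu X t * mslope_mul_sub hX Y ε i
  have hg1 := hgap1 i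
  have hg2 := hgap2 i
  unfold F1
  constructor <;> linarith
end
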